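/- Let A be a locally principal O_X-order of rank d² with generic fiber a central simple F-algebra A^gen. Then the sequence 0 → F*/k* → Div(A) → Pic(A) → 0 is exact, where Div(A) = {Σ n_x x ∈ Div(X) ⊗ Q : e_x(A)·n_x ∈ Z for all x}, the first map is the divisor map and the second sends D to the invertible A-A-bimodule A(D). -/

import Mathlib

set_option synthInstance.maxHeartbeats 1000000
set_option maxHeartbeats 1000000
open Pointwise

/-- An abstract model of a smooth projective geometrically connected curve over `k`:
its function field `F`, its set of closed points with residue degrees, and the discrete
valuations `ord x` attached to the closed points, satisfying the standard axioms
(including the product formula and `H⁰(X, O_X) = k`). -/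
structure AlgCurve (k : Type) [Field k] : Type 1 where
  F : Type
  [fieldF : Field F]
  [algkF : Algebra k F]
  Point : Type
  deg : Point → ℕ
  deg_pos : ∀ x, 0 < deg x
  ord : Point → F → ℤ
  ord_mul : ∀ (x) (a b : F), a ≠ 0 → b ≠ 0 → ord x (a * b) = ord x a + ord x b
  ord_neg : ∀ (x) (a : F), ord x (-a) = ord x a
  ord_add : ∀ (x) (a b : F), a ≠ 0 → b ≠ 0 → a + b ≠ 0 →
    min (ord x a) (ord x b) ≤ ord x (a + b)
  ord_exists_uniformizer : ∀ x, ∃ f : F, f ≠ 0 ∧ ord x f = 1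
  ord_algebraMap : ∀ (x) (c : k), c ≠ 0 → ord x (algebraMap k F c) = 0
  ord_support_finite : ∀ f : F, f ≠ 0 → {x | ord x f ≠ 0}.Finite
  product_formula : ∀ f : F, f ≠ 0 → ∀ s : Finset Point,
    {x | ord x f ≠ 0} ⊆ ↑s → ∑ x ∈ s, ord x f * (deg x : ℤ) = 0
  constants : ∀ f : F, f ≠ 0 → (∀ x, 0 ≤ ord x f) → ∃ c : k, algebraMap k F c = f

attribute [instance] AlgCurve.fieldF AlgCurve.algkF

namespace AlgCurve

variable {k : Type} [Field k] (C : AlgCurve k)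

lemma ord_one (x : C.Point) : C.ord x 1 = 0 := by
  have h := C.ord_mul x 1 1 one_ne_zero one_ne_zero
  rw [one_mul] at h; omega

/-- The local ring of the curve at a closed point `x`, as a subring of `F`. -/
def O (x : C.Point) : Subring C.F where
  carrier := {f | f = 0 ∨ 0 ≤ C.ord x f}
  zero_mem' := Or.inl rfl
  one_mem' := Or.inr (by rw [C.ord_one x])
  add_mem' := by
    rintro a b (rfl | ha) hb
    · simpa using hb
    rcases hb with rfl | hb
    · simpa using Or.inr ha
    by_cases hab : a + b = 0
    · exact Or.inl hab
    by_cases ha0 : a = 0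
    · subst ha0; simpa using Or.inr hb
    by_cases hb0 : b = 0
    · subst hb0; simpa using Or.inr ha
    refine Or.inr ?_
    have := C.ord_add x a b ha0 hb0 hab
    have hmin : (0:ℤ) ≤ min (C.ord x a) (C.ord x b) := le_min ha hb
    omega
  neg_mem' := by
    rintro a (rfl | ha)
    · simp
    · exact Or.inr (by rw [C.ord_neg x a]; exact ha)
  mul_mem' := by
    rintro a b (rfl | ha) hb
    · simp
    rcases hb with rfl | hb
    · simp
    by_cases ha0 : a = 0
    · subst ha0; simp
    by_cases hb0 : b = 0
    · subst hb0; simp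
    exact Or.inr (by rw [C.ord_mul x a b ha0 hb0]; omega)

end AlgCurve

/-- A family of lattices defining a locally free sheaf on the curve with generic fiber `V`. -/
def IsLatticeFamily {k : Type} [Field k] (C : AlgCurve k) (V : Type) [AddCommGroup V]
    [Module C.F V] (L : ∀ x : C.Point, Submodule ↥(C.O x) V) : Prop :=
  (∀ x, Module.Finite ↥(C.O x) ↥(L x)) ∧
  (∀ x, Submodule.span C.F ((L x : Set V)) = ⊤) ∧
  (∃ (n : ℕ) (g : Fin n → V), {x | L x ≠ Submodule.span ↥(C.O x) (Set.range g)}.Finite)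

def leftJacobson (R : Type) [Ring R] : Ideal R := (⊥ : Ideal R).jacobson

/-- The Jacobson radical of an order over a commutative base ring, as a submodule. -/
def radSubG (R A : Type) [CommRing R] [Ring A] [Algebra R A] (Λ : Subalgebra R A) :
    Submodule R A :=
  Submodule.map Λ.val.toLinearMap ((leftJacobson Λ).restrictScalars R)

/-- A sheaf of `O_X`-orders in the `F`-algebra `A`, given by its family of local orders. -/
structure SheafOrder {k : Type} [Field k] (C : AlgCurve k) (A : Type) [Ring A]
    [Algebra C.F A] : Type 1 where
  Λ : ∀ x : C.Point, Subalgebra ↥(C.O x) A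
  lattice : IsLatticeFamily C A (fun x => (Λ x).toSubmodule)

/-- The sheaf order is hereditary: all its local orders are hereditary. -/
def SheafOrder.IsHereditary {k : Type} [Field k] {C : AlgCurve k} {A : Type} [Ring A]
    [Algebra C.F A] (D : SheafOrder C A) : Prop :=
  ∀ x, ∀ I : Ideal (D.Λ x), Module.Projective (D.Λ x) I

/-- `e_x(D) = e`: the local order at `x` has index `e`, i.e. `rad^e = ϖ_x · Λ_x`. -/
def SheafOrder.HasIndexAt {k : Type} [Field k] {C : AlgCurve k} {A : Type} [Ring A]
    [Algebra C.F A] (D : SheafOrder C A) (x : C.Point) (e : ℕ) : Prop :=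
  ∃ ϖ : ↥(C.O x), C.ord x ϖ = 1 ∧
    (radSubG ↥(C.O x) A (D.Λ x)) ^ e = ϖ • (D.Λ x).toSubmodule

/-- The local order at `x` is principal: its radical is generated by one element. -/
def SheafOrder.IsPrincipalAt {k : Type} [Field k] {C : AlgCurve k} {A : Type} [Ring A]
    [Algebra C.F A] (D : SheafOrder C A) (x : C.Point) : Prop :=
  ∃ π : A, π ∈ D.Λ x ∧
    (D.Λ x).toSubmodule * Submodule.span ↥(C.O x) {π} = radSubG ↥(C.O x) A (D.Λ x) ∧
    Submodule.span ↥(C.O x) {π} * (D.Λ x).toSubmodule = radSubG ↥(C.O x) A (D.Λ x)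

/-!
Statement 15: Two hereditary `O_X`-orders `D₁ ⊆ A₁`, `D₂ ⊆ A₂` over a smooth projective
geometrically connected curve are Morita equivalent iff `A₁`, `A₂` are Brauer equivalent
and `e_x(D₁) = e_x(D₂)` for all closed points `x`.  Morita equivalence is formalized by
the existence of an invertible bimodule sheaf, given as a Morita context: generic
bimodules `I`, `J` with balanced pairings `μ`, `ν` which are associative and surjective,
together with compatible lattice families which are surjective locally at every point.
-/

/-- An invertible bimodule sheaf between two sheaf orders, presented as a Morita context
with lattice data. -/
structure MoritaContext {k : Type} [Field k] (C : AlgCurve k)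
    (A₁ : Type) [Ring A₁] [Algebra C.F A₁] (A₂ : Type) [Ring A₂] [Algebra C.F A₂]
    (D₁ : SheafOrder C A₁) (D₂ : SheafOrder C A₂) : Type 1 where
  I : Type
  J : Type
  [acgI : AddCommGroup I]
  [acgJ : AddCommGroup J]
  [modFI : Module C.F I]
  [modFJ : Module C.F J]
  [mod1I : Module A₁ I]
  [mod2I : Module A₂ᵐᵒᵖ I]
  [commI : SMulCommClass A₁ A₂ᵐᵒᵖ I]
  [tow1I : IsScalarTower C.F A₁ I]
  [tow2I : IsScalarTower C.F A₂ᵐᵒᵖ I]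
  [mod2J : Module A₂ J]
  [mod1J : Module A₁ᵐᵒᵖ J]
  [commJ : SMulCommClass A₂ A₁ᵐᵒᵖ J]
  [tow2J : IsScalarTower C.F A₂ J]
  [tow1J : IsScalarTower C.F A₁ᵐᵒᵖ J]
  μ : I → J → A₁
  ν : J → I → A₂
  μ_add_left : ∀ v v' w, μ (v + v') w = μ v w + μ v' w
  μ_add_right : ∀ v w w', μ v (w + w') = μ v w + μ v w'
  ν_add_left : ∀ w w' v, ν (w + w') v = ν w v + ν w' v
  ν_add_right : ∀ w v v', ν w (v + v') = ν w v + ν w v'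
  μ_smul_left : ∀ (a : A₁) v w, μ (a • v) w = a * μ v w
  μ_smul_right : ∀ (a : A₁) v w, μ v (MulOpposite.op a • w) = μ v w * a
  μ_balanced : ∀ (b : A₂) v w, μ (MulOpposite.op b • v) w = μ v (b • w)
  ν_smul_left : ∀ (b : A₂) w v, ν (b • w) v = b * ν w v
  ν_smul_right : ∀ (b : A₂) w v, ν w (MulOpposite.op b • v) = ν w v * b
  ν_balanced : ∀ (a : A₁) w v, ν (MulOpposite.op a • w) v = ν w (a • v)
  assoc₁ : ∀ v w v', μ v w • v' = MulOpposite.op (ν w v') • v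
  assoc₂ : ∀ w v w', ν w v • w' = MulOpposite.op (μ v w') • w
  μ_surjective : Submodule.span C.F {a : A₁ | ∃ v w, a = μ v w} = ⊤
  ν_surjective : Submodule.span C.F {b : A₂ | ∃ w v, b = ν w v} = ⊤
  LI : ∀ x : C.Point, Submodule ↥(C.O x) I
  LJ : ∀ x : C.Point, Submodule ↥(C.O x) J
  latticeI : IsLatticeFamily C I LI
  latticeJ : IsLatticeFamily C J LJ
  stabI_left : ∀ x, ∀ a ∈ D₁.Λ x, ∀ v ∈ LI x, a • v ∈ LI x
  stabI_right : ∀ x, ∀ b ∈ D₂.Λ x, ∀ v ∈ LI x, MulOpposite.op b • v ∈ LI x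
  stabJ_left : ∀ x, ∀ b ∈ D₂.Λ x, ∀ w ∈ LJ x, b • w ∈ LJ x
  stabJ_right : ∀ x, ∀ a ∈ D₁.Λ x, ∀ w ∈ LJ x, MulOpposite.op a • w ∈ LJ x
  μ_local : ∀ x, Submodule.span ↥(C.O x) {a : A₁ | ∃ v ∈ LI x, ∃ w ∈ LJ x, a = μ v w} =
    (D₁.Λ x).toSubmodule
  ν_local : ∀ x, Submodule.span ↥(C.O x) {b : A₂ | ∃ w ∈ LJ x, ∃ v ∈ LI x, b = ν w v} =
    (D₂.Λ x).toSubmodule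

/-- Brauer equivalence of central simple `F`-algebras. -/
def BrauerEquivalent (F A₁ A₂ : Type) [Field F] [Ring A₁] [Algebra F A₁] [Ring A₂]
    [Algebra F A₂] : Prop :=
  ∃ n m : ℕ, 0 < n ∧ 0 < m ∧
    Nonempty (Matrix (Fin n) (Fin n) A₁ ≃ₐ[F] Matrix (Fin m) (Fin m) A₂)


/-!
Statement 18: For a locally principal `O_X`-order `D` of rank `d²`, the sequence
`0 → F*/k* → Div(D) → Pic(D) → 0` is exact.  Elements of `Div(D)` are represented by
finitely supported functions `m : |X| → ℤ` (with `n_x = m_x / e_x`), invertible `D`-`D`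
bimodules by invertible families `T` of two-sided fractional ideals, `D(m)` by the
characterizing property `T_x · rad^{m_x⁺} = Λ_x · rad^{m_x⁻}`, and isomorphism of
bimodules by global scaling by an element of `F*`.  Exactness comprises: injectivity of
the divisor map modulo constants, existence of `D(m)`, the kernel computation
(`D(m)` trivial iff `m` is the divisor of a function), and surjectivity of `m ↦ D(m)`.
-/

section Pic

variable {k : Type} [Field k] (C : AlgCurve k)
variable (A : Type) [Ring A] [Algebra C.F A]

/-- A family of fractional two-sided ideals defining an invertible `D`-`D`-bimodule. -/
def IsInvBimodFamily (D : SheafOrder C A) (T : ∀ x : C.Point, Submodule ↥(C.O x) A) :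
    Prop :=
  (∀ x, (D.Λ x).toSubmodule * T x = T x) ∧
  (∀ x, T x * (D.Λ x).toSubmodule = T x) ∧
  (∀ x, ∃ T' : Submodule ↥(C.O x) A,
    T x * T' = (D.Λ x).toSubmodule ∧ T' * T x = (D.Λ x).toSubmodule) ∧
  {x | T x ≠ (D.Λ x).toSubmodule}.Finite

/-- `T` represents the invertible bimodule `D(m)`, where the divisor `Σ (m_x/e_x)·x` is
encoded by its numerators `m : |X| → ℤ`: locally, `T_x = rad_x^{-m_x}`. -/
def IsTwistBimod (D : SheafOrder C A) (m : C.Point → ℤ)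
    (T : ∀ x : C.Point, Submodule ↥(C.O x) A) : Prop :=
  IsInvBimodFamily C A D T ∧
  ∀ x, T x * (radSubG ↥(C.O x) A (D.Λ x)) ^ (m x).toNat =
    (D.Λ x).toSubmodule * (radSubG ↥(C.O x) A (D.Λ x)) ^ (-(m x)).toNat

end Pic

namespace PicAux

/-- The corner monoid `{a : l a = a = a l}` of an idempotent `l`. -/
def Corner {S : Type} [Semigroup S] {l : S} (_hl : l * l = l) : Type :=
  {a : S // l * a = a ∧ a * l = a}

instance {S : Type} [Semigroup S] {l : S} (hl : l * l = l) : Monoid (Corner hl) where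
  mul a b := ⟨a.1 * b.1, by rw [← mul_assoc, a.2.1], by rw [mul_assoc, b.2.2]⟩
  mul_assoc a b c := Subtype.ext (mul_assoc _ _ _)
  one := ⟨l, hl, hl⟩
  one_mul a := Subtype.ext a.2.1
  mul_one a := Subtype.ext a.2.2

theorem Corner.val_mul {S : Type} [Semigroup S] {l : S} (hl : l * l = l) (a b : Corner hl) :
    (a * b).1 = a.1 * b.1 := rfl

theorem Corner.val_one {S : Type} [Semigroup S] {l : S} (hl : l * l = l) :
    (1 : Corner hl).1 = l := rfl

theorem Corner.val_pow {S : Type} [Monoid S] {l : S} (hl : l * l = l) (a : Corner hl) (n : ℕ) :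
    (a ^ n).1 = l * a.1 ^ n := by
  induction n with
  | zero => rw [pow_zero, pow_zero, mul_one]; rfl
  | succ n ih => rw [pow_succ, pow_succ, Corner.val_mul, ih, mul_assoc]

section rad
variable {R A : Type} [CommRing R] [Ring A] [Algebra R A] (Λ : Subalgebra R A)

theorem mem_rad {a : A} : a ∈ radSubG R A Λ ↔ ∃ h : a ∈ Λ, (⟨a, h⟩ : Λ) ∈ leftJacobson Λ := by
  unfold radSubG
  simp only [Submodule.mem_map, Submodule.restrictScalars_mem]
  constructor
  · rintro ⟨y, hy, rfl⟩; exact ⟨y.2, hy⟩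
  · rintro ⟨h, hy⟩; exact ⟨_, hy, rfl⟩

theorem rad_le : radSubG R A Λ ≤ Λ.toSubmodule := fun a ha => ((mem_rad Λ).1 ha).1

instance : (leftJacobson Λ).IsTwoSided := by unfold leftJacobson; infer_instance

theorem LL : Λ.toSubmodule * Λ.toSubmodule = Λ.toSubmodule := by
  apply le_antisymm
  · exact Submodule.mul_le.2 fun a ha b hb => Λ.mul_mem ha hb
  · intro a ha
    have := Submodule.mul_mem_mul (show (1:A) ∈ Λ.toSubmodule from Λ.one_mem) ha
    rwa [one_mul] at this

theorem L_mul_eq {X : Submodule R A} (h : Λ.toSubmodule * X ≤ X) : Λ.toSubmodule * X = X := by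
  apply le_antisymm h
  intro a ha
  have := Submodule.mul_mem_mul (show (1:A) ∈ Λ.toSubmodule from Λ.one_mem) ha
  rwa [one_mul] at this

theorem mul_L_eq {X : Submodule R A} (h : X * Λ.toSubmodule ≤ X) : X * Λ.toSubmodule = X := by
  apply le_antisymm h
  intro a ha
  have := Submodule.mul_mem_mul ha (show (1:A) ∈ Λ.toSubmodule from Λ.one_mem)
  rwa [mul_one] at this

theorem L_rad : Λ.toSubmodule * radSubG R A Λ = radSubG R A Λ := by
  apply L_mul_eq
  refine Submodule.mul_le.2 fun a ha b hb => ?_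
  obtain ⟨h, hb⟩ := (mem_rad Λ).1 hb
  exact (mem_rad Λ).2 ⟨Λ.mul_mem ha h, Ideal.mul_mem_left (leftJacobson Λ) ⟨a, ha⟩ hb⟩

theorem rad_L : radSubG R A Λ * Λ.toSubmodule = radSubG R A Λ := by
  apply mul_L_eq
  refine Submodule.mul_le.2 fun b hb a ha => ?_
  obtain ⟨h, hb⟩ := (mem_rad Λ).1 hb
  exact (mem_rad Λ).2 ⟨Λ.mul_mem h ha, Ideal.mul_mem_right (I := leftJacobson Λ) ⟨a, ha⟩ hb⟩

theorem one_notMem_rad [Nontrivial A] : (1 : A) ∉ radSubG R A Λ := by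
  intro h
  obtain ⟨h, h1⟩ := (mem_rad Λ).1 h
  have h2 := (Ideal.eq_top_iff_one _).2 (show (1 : Λ) ∈ leftJacobson Λ from h1)
  unfold leftJacobson at h2
  rw [Ideal.jacobson_eq_top_iff] at h2
  exact bot_ne_top h2

/-- Left quasi-inverse: `1 - r` has a left inverse. -/
theorem exists_left_inv {r : A} (h : r ∈ radSubG R A Λ) : ∃ z ∈ Λ, z * (1 - r) = 1 := by
  obtain ⟨h, h1⟩ := (mem_rad Λ).1 h
  obtain ⟨z, hz⟩ := Ideal.mem_jacobson_iff.1 h1 (-1)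
  refine ⟨z, z.2, ?_⟩
  have hz' : z * (-1) * (⟨r, h⟩ : Λ) + z - 1 = 0 := hz
  have := congrArg (Subtype.val) hz'
  simp at this
  rw [mul_sub, mul_one, ← sub_eq_zero, ← this]; abel

theorem mem_rad_of {X : Submodule R A} (hX : X ≤ Λ.toSubmodule) (hX2 : Λ.toSubmodule * X ≤ X)
    {n : ℕ} (hn : X ^ n ≤ radSubG R A Λ) : X ≤ radSubG R A Λ := by
  intro a ha
  refine (mem_rad Λ).2 ⟨hX ha, Ideal.mem_jacobson_iff.2 fun y => ?_⟩
  have hya : -((y : A) * a) ∈ X := X.neg_mem (hX2 (Submodule.mul_mem_mul y.2 ha))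
  have h1 := hn (Submodule.pow_mem_pow X hya n)
  obtain ⟨z, hz, hz1⟩ := exists_left_inv Λ h1
  have h2 := mul_geom_sum (-((y : A) * a)) n
  have h3 := geom_sum_mul_neg (-((y : A) * a)) n
  have h4 : (∑ i ∈ Finset.range n, (-((y : A) * a)) ^ i) ∈ Λ :=
    Λ.sum_mem fun i _ => Λ.pow_mem (hX hya) i
  refine ⟨⟨z, hz⟩ * ⟨_, h4⟩, ?_⟩
  rw [Ideal.mem_bot]
  apply Subtype.ext
  rw [← h3] at hz1
  simp only [Subalgebra.coe_sub, Subalgebra.coe_add, Subalgebra.coe_mul, Subalgebra.coe_one, Subalgebra.coe_zero]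
  rw [← hz1]
  noncomm_ring

end rad
end PicAux
namespace PicAux

section semis
variable {R A : Type} [CommRing R] [Ring A] [Algebra R A] (Λ : Subalgebra R A)

theorem isArtinian_quot (ϖ : R) (hnu : ¬ IsUnit ϖ) (hunit : ∀ s : R, IsUnit s ∨ ϖ ∣ s)
    [Module.Finite R Λ.toSubmodule] (hϖ : ∀ a ∈ Λ, ϖ • a ∈ radSubG R A Λ) :
    IsArtinianRing (Λ ⧸ leftJacobson Λ) := by
  have hfin : Module.Finite R Λ := ‹Module.Finite R Λ.toSubmodule›
  let J := leftJacobson Λ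
  have hmax : (Ideal.span {ϖ}).IsMaximal := by
    rw [Ideal.isMaximal_iff]
    constructor
    · intro h; rw [Ideal.mem_span_singleton] at h; exact hnu (isUnit_of_dvd_one h)
    · intro I x hI hx hxI
      rcases hunit x with h | h
      · rw [Ideal.eq_top_of_isUnit_mem I hxI h]; trivial
      · exact absurd (Ideal.mem_span_singleton.2 h) hx
  have htor : Module.IsTorsionBySet R (Λ ⧸ J) (Ideal.span {ϖ} : Ideal R) := by
    rw [Module.isTorsionBySet_span_singleton_iff]
    intro b
    obtain ⟨b, rfl⟩ := Ideal.Quotient.mk_surjective b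
    have h1 : (ϖ • b) ∈ J := ((mem_rad Λ).1 (hϖ b b.2)).2
    have h2 := Ideal.Quotient.eq_zero_iff_mem.2 h1
    rw [← h2]; rfl
  let _ := htor.module
  have : IsScalarTower R (R ⧸ (Ideal.span {ϖ} : Ideal R)) (Λ ⧸ J) := htor.isScalarTower
  let _ := Ideal.Quotient.field (Ideal.span {ϖ} : Ideal R)
  have hf : Module.Finite R (Λ ⧸ J) := by
    let g : Λ →ₗ[R] (Λ ⧸ J) :=
      { toFun := Ideal.Quotient.mk J, map_add' := map_add _, map_smul' := fun _ _ => rfl }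
    exact Module.Finite.of_surjective g Ideal.Quotient.mk_surjective
  have : Module.Finite (R ⧸ (Ideal.span {ϖ} : Ideal R)) (Λ ⧸ J) :=
    Module.Finite.of_restrictScalars_finite R _ _
  have h3 : IsArtinian (R ⧸ (Ideal.span {ϖ} : Ideal R)) (Λ ⧸ J) := inferInstance
  have h4 : IsArtinian R (Λ ⧸ J) :=
    (LinearMap.isArtinian_iff_of_bijective
      ({ toFun := id, map_add' := fun _ _ => rfl, map_smul' := fun r x => by
          change r • x = (Ideal.Quotient.mk (Ideal.span {ϖ}) r) • x; rfl } :
        (Λ ⧸ J) →ₛₗ[Ideal.Quotient.mk (Ideal.span {ϖ} : Ideal R)] (Λ ⧸ J))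
        Function.bijective_id).2 h3
  exact isArtinian_of_tower R h4

theorem exists_right_id (ϖ : R) (hnu : ¬ IsUnit ϖ) (hunit : ∀ s : R, IsUnit s ∨ ϖ ∣ s)
    [Module.Finite R Λ.toSubmodule] (hϖ : ∀ a ∈ Λ, ϖ • a ∈ radSubG R A Λ)
    {T : Submodule R A} (hT : T ≤ Λ.toSubmodule) (hLT : Λ.toSubmodule * T ≤ T)
    (hTL : T * Λ.toSubmodule ≤ T) : ∃ i ∈ T, ∀ t ∈ T, t * (1 - i) ∈ radSubG R A Λ := by
  have hart := isArtinian_quot Λ ϖ hnu hunit hϖ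
  let J := leftJacobson Λ
  have hss : IsSemisimpleRing (Λ ⧸ J) :=
    IsArtinianRing.isSemisimpleRing_iff_jacobson.2 (by
      have h := Ring.jacobson_quotient_jacobson Λ
      have e : J = Ring.jacobson Λ := Ideal.jacobson_bot
      have : ∀ (I : Ideal Λ) [I.IsTwoSided], I = Ring.jacobson Λ →
        Ring.jacobson (Λ ⧸ I) = ⊥ := by
        rintro I _ rfl; exact h
      exact this J e)
  let I : Ideal Λ :=
    { carrier := {a | (a : A) ∈ T}
      add_mem' := fun ha hb => T.add_mem ha hb
      zero_mem' := T.zero_mem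
      smul_mem' := fun c a ha => hLT (Submodule.mul_mem_mul c.2 ha) }
  let π := Ideal.Quotient.mk J
  let Ib : Ideal (Λ ⧸ J) := I.map π
  obtain ⟨Lb, hLb⟩ := exists_isCompl Ib
  have h1 : (1 : Λ ⧸ J) ∈ Ib ⊔ Lb := by rw [hLb.sup_eq_top]; trivial
  obtain ⟨i, hi, j, hj, hij⟩ := Submodule.mem_sup.1 h1
  obtain ⟨i, hiI, rfl⟩ := (Ideal.mem_map_iff_of_surjective π Ideal.Quotient.mk_surjective).1 hi
  refine ⟨i, hiI, fun t ht => ?_⟩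
  have hj' : π (1 - i) = j := by rw [map_sub, map_one, ← hij]; abel
  have ha : π (⟨t, hT ht⟩ * (1 - i)) ∈ Lb := by
    rw [map_mul, hj']; exact Lb.mul_mem_left _ hj
  have hb : π (⟨t, hT ht⟩ * (1 - i)) ∈ Ib := by
    apply Ideal.mem_map_of_mem
    exact hTL (Submodule.mul_mem_mul ht (1 - i).2)
  have hc : π (⟨t, hT ht⟩ * (1 - i)) = 0 := by
    have : π (⟨t, hT ht⟩ * (1 - i)) ∈ Ib ⊓ Lb := ⟨hb, ha⟩
    rwa [hLb.inf_eq_bot] at this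
  exact (mem_rad Λ).2 ⟨_, Ideal.Quotient.eq_zero_iff_mem.1 hc⟩

end semis

section fieldpart
variable {F A : Type} [Field F] [Ring A] [Algebra F A] {O : Subring F}

theorem smul_mul' (f : F) (X Y : Submodule O A) : (f • X) * Y = f • (X * Y) := by
  apply le_antisymm
  · refine Submodule.mul_le.2 fun a ha b hb => ?_
    obtain ⟨a, ha0, rfl⟩ := (Submodule.mem_smul_pointwise_iff_exists _ _ _).1 ha
    rw [smul_mul_assoc]
    exact Submodule.smul_mem_pointwise_smul _ _ _ (Submodule.mul_mem_mul ha0 hb)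
  · intro c hc
    obtain ⟨c, hc0, rfl⟩ := (Submodule.mem_smul_pointwise_iff_exists _ _ _).1 hc
    clear hc
    induction hc0 using Submodule.mul_induction_on' with
    | mem_mul_mem a ha b hb =>
      rw [← smul_mul_assoc]
      exact Submodule.mul_mem_mul (Submodule.smul_mem_pointwise_smul _ _ _ ha) hb
    | add a _ b _ ha hb =>
      rw [smul_add]
      exact Submodule.add_mem _ ha hb

theorem mul_smul' (f : F) (X Y : Submodule O A) : X * (f • Y) = f • (X * Y) := by
  apply le_antisymm
  · refine Submodule.mul_le.2 fun a ha b hb => ?_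
    obtain ⟨b, hb0, rfl⟩ := (Submodule.mem_smul_pointwise_iff_exists _ _ _).1 hb
    rw [mul_smul_comm]
    exact Submodule.smul_mem_pointwise_smul _ _ _ (Submodule.mul_mem_mul ha hb0)
  · intro c hc
    obtain ⟨c, hc0, rfl⟩ := (Submodule.mem_smul_pointwise_iff_exists _ _ _).1 hc
    clear hc
    induction hc0 using Submodule.mul_induction_on' with
    | mem_mul_mem a ha b hb =>
      rw [← mul_smul_comm]
      exact Submodule.mul_mem_mul ha (Submodule.smul_mem_pointwise_smul _ _ _ hb)
    | add a _ b _ ha hb =>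
      rw [smul_add]
      exact Submodule.add_mem _ ha hb

/-- every element is in `Λ` after multiplying by a power of `ϖ` -/
theorem exists_pow_smul_mem (Λ : Subalgebra O A) (ϖ : O)
    (hden : ∀ f : F, ∃ n : ℕ, (ϖ : F) ^ n * f ∈ O)
    (hspan : Submodule.span F (Λ : Set A) = ⊤) (a : A) : ∃ n : ℕ, ϖ ^ n • a ∈ Λ := by
  have ha : a ∈ Submodule.span F (Λ : Set A) := by rw [hspan]; trivial
  induction ha using Submodule.span_induction with
  | mem a ha => exact ⟨0, by simpa using ha⟩
  | zero => exact ⟨0, by simp [Λ.zero_mem]⟩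
  | add a b _ _ ha hb =>
    obtain ⟨n, hn⟩ := ha
    obtain ⟨m, hm⟩ := hb
    refine ⟨n + m, ?_⟩
    rw [smul_add]
    refine Λ.add_mem ?_ ?_
    · rw [add_comm, pow_add, mul_smul]; exact Λ.smul_mem hn _
    · rw [pow_add, mul_smul]; exact Λ.smul_mem hm _
  | smul f a _ ha =>
    obtain ⟨n, hn⟩ := ha
    obtain ⟨m, hm⟩ := hden f
    refine ⟨m + n, ?_⟩
    have : ϖ ^ (m + n) • f • a = (⟨_, hm⟩ : O) • (ϖ ^ n • a) := by
      change ((ϖ ^ (m + n) : O) : F) • f • a = ((ϖ : F) ^ m * f) • (((ϖ ^ n : O) : F) • a)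
      rw [smul_smul, smul_smul]; congr 1; push_cast; ring
    rw [this]
    exact Λ.smul_mem hn _

theorem exists_pow_smul_mem_finset (Λ : Subalgebra O A) (ϖ : O)
    (hden : ∀ f : F, ∃ n : ℕ, (ϖ : F) ^ n * f ∈ O)
    (hspan : Submodule.span F (Λ : Set A) = ⊤) (s : Finset A) :
    ∃ n : ℕ, ∀ a ∈ s, ϖ ^ n • a ∈ Λ := by
  choose N hN using exists_pow_smul_mem Λ ϖ hden hspan
  refine ⟨s.sup N, fun a ha => ?_⟩
  rw [← Nat.sub_add_cancel (Finset.le_sup (f := N) ha), pow_add, mul_smul]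
  exact Λ.smul_mem (hN a) _

/-- approximately central elements are approximately scalars -/
theorem exists_central_bound [Algebra.IsCentral F A] [FiniteDimensional F A]
    (Λ : Subalgebra O A) (ϖ : O)
    (hden : ∀ f : F, ∃ n : ℕ, (ϖ : F) ^ n * f ∈ O)
    (hspan : Submodule.span F (Λ : Set A) = ⊤) [Module.Finite O Λ.toSubmodule] :
    ∃ c : ℕ, ∀ e : A, (∀ a ∈ Λ, ∃ l ∈ Λ, e * a - a * e = ϖ ^ (c + 1) • l) →
      ∃ s : F, ∃ l ∈ Λ, e = s • 1 + ϖ • l := by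
  classical
  obtain ⟨S, hS⟩ := (Module.Finite.iff_fg (N := Λ.toSubmodule)).1 inferInstance
  have hSΛ : ∀ b ∈ S, b ∈ Λ := fun b hb => by
    have : b ∈ Λ.toSubmodule := hS ▸ Submodule.subset_span hb
    exact this
  let φ : A →ₗ[F] (S → A) := LinearMap.pi fun b =>
    LinearMap.mulRight F (b : A) - LinearMap.mulLeft F (b : A)
  have hφ : ∀ e b, φ e b = e * b - b * e := fun e b => rfl
  -- generalized inverse
  obtain ⟨q, hq⟩ := Submodule.exists_isCompl (LinearMap.ker φ)
  have hinj : LinearMap.ker (φ.domRestrict q) = ⊥ := by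
    rw [LinearMap.ker_eq_bot']
    intro m hm
    have : (m : A) ∈ LinearMap.ker φ ⊓ q := ⟨hm, m.2⟩
    rw [hq.inf_eq_bot] at this
    exact Subtype.ext this
  obtain ⟨g, hg⟩ := LinearMap.exists_leftInverse_of_injective _ hinj
  let ψ : (S → A) →ₗ[F] A := q.subtype ∘ₗ g
  have hψ : ∀ e, φ (e - ψ (φ e)) = 0 := by
    intro e
    have : e ∈ LinearMap.ker φ ⊔ q := by rw [hq.sup_eq_top]; trivial
    obtain ⟨u, hu, v, hv, rfl⟩ := Submodule.mem_sup.1 this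
    have hu' : φ u = 0 := hu
    have h1 : g (φ v) = ⟨v, hv⟩ := LinearMap.congr_fun hg ⟨v, hv⟩
    have h2 : ψ (φ v) = v := by change ((g (φ v) : q) : A) = v; rw [h1]
    rw [map_add φ u v, hu', zero_add, h2]; simp [hu']
  have hker : ∀ z, φ z = 0 → ∃ s : F, z = s • 1 := by
    intro z hz
    have hz1 : ∀ a ∈ Λ, z * a = a * z := by
      intro a ha
      have : a ∈ Submodule.span O (S : Set A) := by rw [hS]; exact ha
      clear ha
      induction this using Submodule.span_induction with
      | mem b hb => exact sub_eq_zero.1 (congrFun hz ⟨b, hb⟩)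
      | zero => simp
      | add a b h1 h2 ha hb => rw [mul_add, add_mul, ha, hb]
      | smul r a h1 ha => rw [mul_smul_comm, smul_mul_assoc, ha]
    have hz2 : z ∈ Subalgebra.center F A := by
      rw [Subalgebra.mem_center_iff]
      intro a
      have ha : a ∈ Submodule.span F (Λ : Set A) := by rw [hspan]; trivial
      induction ha using Submodule.span_induction with
      | mem a ha => exact (hz1 a ha).symm
      | zero => simp
      | add a b _ _ ha hb => rw [mul_add, add_mul, ha, hb]
      | smul f a _ ha => rw [mul_smul_comm, smul_mul_assoc, ha]
    have := Algebra.IsCentral.out (K := F) (D := A) hz2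
    obtain ⟨s, hs⟩ := Algebra.mem_bot.1 this
    exact ⟨s, by rw [← hs, Algebra.algebraMap_eq_smul_one]⟩
  obtain ⟨c, hc⟩ := exists_pow_smul_mem_finset Λ ϖ hden hspan
    ((Finset.univ : Finset (S × S)).image fun p => ψ (Pi.single p.1 (p.2 : A)))
  have hc1 : ∀ (b : S) (l : A), l ∈ Λ → ϖ ^ c • ψ (Pi.single b l) ∈ Λ := by
    intro b l hl
    have : l ∈ Submodule.span O (S : Set A) := by rw [hS]; exact hl
    induction this using Submodule.span_induction with
    | mem b' hb => exact hc _ (Finset.mem_image.2 ⟨(b, ⟨b', hb⟩), Finset.mem_univ _, rfl⟩)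
    | zero => simp [Λ.zero_mem]
    | add a a' h1 h2 ha hb =>
      rw [hS] at h1 h2
      rw [Pi.single_add, map_add, smul_add]; exact Λ.add_mem (ha h1) (hb h2)
    | smul r a h1 ha =>
      rw [hS] at h1
      have : ψ (Pi.single b (r • a)) = r • ψ (Pi.single b a) := by
        change ψ (Pi.single b ((r : F) • a)) = (r : F) • ψ (Pi.single b a)
        rw [Pi.single_smul, map_smul]
      rw [this, smul_comm]
      exact Λ.smul_mem (ha h1) _
  refine ⟨c, fun e he => ?_⟩
  choose l hl hl2 using fun b : S => he b (hSΛ b b.2)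
  obtain ⟨s, hs⟩ := hker _ (hψ e)
  refine ⟨s, ∑ b : S, ϖ ^ c • ψ (Pi.single b (l b)), Λ.sum_mem fun b _ => hc1 b _ (hl b), ?_⟩
  have h1 : φ e = (ϖ ^ (c + 1) : F) • (∑ b : S, Pi.single b (l b)) := by
    rw [Finset.univ_sum_single]
    ext b
    rw [hφ, hl2]
    change ((ϖ ^ (c + 1) : O) : F) • l b = _
    push_cast; rfl
  have h2 : ψ (φ e) = ϖ • ∑ b : S, ϖ ^ c • ψ (Pi.single b (l b)) := by
    rw [h1, map_smul, map_sum, ← Finset.smul_sum, smul_smul, ← pow_succ']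
    rw [← SubmonoidClass.coe_pow]; rfl
  rw [← h2, ← hs]; abel

end fieldpart
end PicAux
namespace PicAux

section ideals
variable {R A : Type} [CommRing R] [Ring A] [Algebra R A] (Λ : Subalgebra R A)

theorem mul_mono {X Y X' Y' : Submodule R A} (h : X ≤ Y) (h' : X' ≤ Y') : X * X' ≤ Y * Y' :=
  Submodule.mul_le.2 fun _ ha _ hb => Submodule.mul_mem_mul (h ha) (h' hb)

theorem mul_mono_left {X Y Z : Submodule R A} (h : X ≤ Y) : X * Z ≤ Y * Z :=
  mul_mono h le_rfl

theorem mul_mono_right {X Y Z : Submodule R A} (h : X ≤ Y) : Z * X ≤ Z * Y :=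
  mul_mono le_rfl h

theorem L_mul_pow {X : Submodule R A} (h : Λ.toSubmodule * X ≤ X) (n : ℕ) :
    Λ.toSubmodule * X ^ (n + 1) ≤ X ^ (n + 1) := by
  rw [pow_succ', ← mul_assoc]; exact mul_mono_left h

theorem pow_mul_L {X : Submodule R A} (h : X * Λ.toSubmodule ≤ X) (n : ℕ) :
    X ^ (n + 1) * Λ.toSubmodule ≤ X ^ (n + 1) := by
  rw [pow_succ, mul_assoc]; exact mul_mono_right h

theorem pow_le_L {X : Submodule R A} (hX : X ≤ Λ.toSubmodule) (n : ℕ) :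
    X ^ n ≤ Λ.toSubmodule := by
  induction n with
  | zero => rw [pow_zero]; exact Submodule.one_le.2 Λ.one_mem
  | succ n ih => rw [pow_succ, ← LL Λ]; exact mul_mono ih hX

theorem pow_le_self {X : Submodule R A} (hX : X ≤ Λ.toSubmodule) (h : Λ.toSubmodule * X ≤ X)
    (n : ℕ) : X ^ (n + 1) ≤ X := by
  rw [pow_succ]; exact (mul_mono_left (pow_le_L Λ hX n)).trans h

end ideals

section fieldpart
variable {F A : Type} [Field F] [Ring A] [Algebra F A] {O : Subring F}

theorem smul_pow_le (Λ : Subalgebra O A) (f : F) (n : ℕ) :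
    (f • Λ.toSubmodule) ^ n ≤ f ^ n • Λ.toSubmodule := by
  induction n with
  | zero => rw [pow_zero, pow_zero, one_smul]; exact Submodule.one_le.2 Λ.one_mem
  | succ n ih =>
    rw [pow_succ]
    refine (mul_mono_left ih).trans ?_
    rw [smul_mul', mul_smul', LL, smul_smul, pow_succ]

theorem conj_rad_le (Λ : Subalgebra O A) (ϖ : F) (e : ℕ) (he : 0 < e)
    (hP : (radSubG O A Λ) ^ e = ϖ • Λ.toSubmodule) {T T' : Submodule O A}
    (h1 : T * T' = Λ.toSubmodule) (h2 : T' * T = Λ.toSubmodule)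
    (hLT : Λ.toSubmodule * T = T) (hTL : T * Λ.toSubmodule = T) :
    T * radSubG O A Λ * T' ≤ radSubG O A Λ := by
  set P := radSubG O A Λ with hPdef
  set L := Λ.toSubmodule with hL
  have hPL : P ≤ L := rad_le Λ
  have hX : T * P * T' ≤ L := by
    calc T * P * T' ≤ T * L * T' := mul_mono_left (mul_mono_right hPL)
      _ = L := by rw [hTL, h1]
  have hpow : ∀ n, (T * P * T') ^ n ≤ T * P ^ n * T' := by
    intro n
    induction n with
    | zero => rw [pow_zero, pow_zero, mul_one, h1]; exact Submodule.one_le.2 Λ.one_mem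
    | succ n ih =>
      rw [pow_succ]
      refine (mul_mono_left ih).trans ?_
      have : T * P ^ n * T' * (T * P * T') = T * P ^ n * ((T' * T) * P) * T' := by
        simp only [mul_assoc]
      rw [this, h2, L_rad, pow_succ]
      simp only [mul_assoc]; exact le_rfl
  refine mem_rad_of Λ hX ?_ (n := e) ?_
  · rw [← mul_assoc, ← mul_assoc, hLT]
  · refine (hpow e).trans ?_
    rw [hP, mul_smul', smul_mul', hTL, h1, ← hP]
    obtain ⟨n, rfl⟩ := Nat.exists_eq_succ_of_ne_zero he.ne'
    exact pow_le_self Λ hPL (L_rad Λ).le n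

theorem comm_rad (Λ : Subalgebra O A) (ϖ : F) (e : ℕ) (he : 0 < e)
    (hP : (radSubG O A Λ) ^ e = ϖ • Λ.toSubmodule) {T T' : Submodule O A}
    (h1 : T * T' = Λ.toSubmodule) (h2 : T' * T = Λ.toSubmodule)
    (hLT : Λ.toSubmodule * T = T) (hTL : T * Λ.toSubmodule = T)
    (hLT' : Λ.toSubmodule * T' = T') (hTL' : T' * Λ.toSubmodule = T') :
    Commute T (radSubG O A Λ) := by
  apply le_antisymm
  · calc T * radSubG O A Λ = T * radSubG O A Λ * T' * T := by
          rw [mul_assoc (T * _), h2, mul_assoc, rad_L]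
      _ ≤ _ := mul_mono_left (conj_rad_le Λ ϖ e he hP h1 h2 hLT hTL)
  · calc radSubG O A Λ * T = T * (T' * radSubG O A Λ * T) := by
          rw [mul_assoc T', ← mul_assoc T, h1, ← mul_assoc, L_rad]
      _ ≤ _ := mul_mono_right (conj_rad_le Λ ϖ e he hP h2 h1 hLT' hTL')

theorem key [Algebra.IsCentral F A] [FiniteDimensional F A] [Nontrivial A]
    (Λ : Subalgebra O A) (ϖ : O)
    (hden : ∀ f : F, ∃ n : ℕ, (ϖ : F) ^ n * f ∈ O)
    (hval : ∀ f : F, f ∉ O → ∃ u : O, f * u * ϖ = 1)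
    (hnu : ¬ IsUnit ϖ) (hunit : ∀ s : O, IsUnit s ∨ ϖ ∣ s)
    (hspan : Submodule.span F (Λ : Set A) = ⊤) [Module.Finite O Λ.toSubmodule]
    (e : ℕ) (he : 0 < e)
    (hP : (radSubG O A Λ) ^ e = (ϖ : F) • Λ.toSubmodule) {T T' : Submodule O A}
    (h1 : T * T' = Λ.toSubmodule) (h2 : T' * T = Λ.toSubmodule)
    (hLT : Λ.toSubmodule * T = T) (hTL : T * Λ.toSubmodule = T)
    (hLT' : Λ.toSubmodule * T' = T') (hTL' : T' * Λ.toSubmodule = T')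
    (hT : T ≤ Λ.toSubmodule) (hTP : ¬ T ≤ radSubG O A Λ) : T = Λ.toSubmodule := by
  have hcomm : Commute T (radSubG O A Λ) := comm_rad Λ ϖ e he hP h1 h2 hLT hTL hLT' hTL'
  have hone := one_notMem_rad Λ (R := O)
  have hLP := L_rad Λ
  have hPL := rad_L Λ
  have hPle : radSubG O A Λ ≤ Λ.toSubmodule := rad_le Λ
  have hϖ : ∀ a ∈ Λ, ϖ • a ∈ radSubG O A Λ := by
    intro a ha
    obtain ⟨n, rfl⟩ := Nat.exists_eq_succ_of_ne_zero he.ne'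
    apply pow_le_self Λ hPle hLP.le n
    rw [hP]
    exact Submodule.smul_mem_pointwise_smul a (ϖ : F) _ ha
  obtain ⟨i, hiT, hi⟩ := exists_right_id Λ ϖ hnu hunit hϖ hT hLT.le hTL.le
  obtain ⟨c, hc⟩ := exists_central_bound Λ ϖ hden hspan
  have hlinv := fun r => exists_left_inv Λ (r := r)
  have hnil := fun (X : Submodule O A) (a) (b) => mem_rad_of Λ (X := X) a b (n := 2)
  set P := radSubG O A Λ with hPdef
  set L := Λ.toSubmodule with hLdef
  let J : Submodule O A :=
    { carrier := {a | a ∈ L ∧ ∀ t ∈ T, t * a ∈ P}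
      add_mem' := fun ha hb => ⟨L.add_mem ha.1 hb.1, fun t ht => by
        rw [mul_add]; exact P.add_mem (ha.2 t ht) (hb.2 t ht)⟩
      zero_mem' := ⟨L.zero_mem, fun t ht => by rw [mul_zero]; exact P.zero_mem⟩
      smul_mem' := fun r a ha => ⟨L.smul_mem r ha.1, fun t ht => by
        rw [mul_smul_comm]; exact P.smul_mem r (ha.2 t ht)⟩ }
  have hJL : J ≤ L := fun a ha => ha.1
  have hTJ : T * J ≤ P := Submodule.mul_le.2 fun t ht a ha => ha.2 t ht
  have hLJ : L * J ≤ J := Submodule.mul_le.2 fun l hl a ha =>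
    ⟨Λ.mul_mem hl ha.1, fun t ht => by
      rw [← mul_assoc]; exact ha.2 _ (hTL.le (Submodule.mul_mem_mul ht hl))⟩
  have hJL2 : J * L ≤ J := Submodule.mul_le.2 fun a ha l hl =>
    ⟨Λ.mul_mem ha.1 hl, fun t ht => by
      rw [← mul_assoc]; exact hPL.le (Submodule.mul_mem_mul (ha.2 t ht) hl)⟩
  have hJT : J * T ≤ P := by
    apply hnil
    · exact (mul_mono hJL hT).trans (LL Λ).le
    · rw [← mul_assoc]; exact mul_mono_left hLJ
    · rw [pow_two]
      calc J * T * (J * T) = J * (T * J) * T := by simp only [mul_assoc]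
        _ ≤ L * P * L := mul_mono (mul_mono hJL hTJ) hT
        _ = P := by rw [hLP, hPL]
  have hTnJn : ∀ n, T ^ n * J ^ n ≤ P ^ n := by
    intro n
    induction n with
    | zero => simp
    | succ n ih =>
      calc T ^ (n + 1) * J ^ (n + 1) = T ^ n * (T * J) * J ^ n := by
            rw [pow_succ, pow_succ']; simp only [mul_assoc]
        _ ≤ T ^ n * P * J ^ n := mul_mono_left (mul_mono_right hTJ)
        _ = P * (T ^ n * J ^ n) := by rw [(hcomm.pow_left n).eq, mul_assoc]
        _ ≤ P * P ^ n := mul_mono_right ih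
        _ = P ^ (n + 1) := (pow_succ' _ _).symm
  have hJnTn : ∀ n, J ^ n * T ^ n ≤ P ^ n := by
    intro n
    induction n with
    | zero => simp
    | succ n ih =>
      calc J ^ (n + 1) * T ^ (n + 1) = J ^ n * (J * T) * T ^ n := by
            rw [pow_succ, pow_succ']; simp only [mul_assoc]
        _ ≤ J ^ n * P * T ^ n := mul_mono_left (mul_mono_right hJT)
        _ = (J ^ n * T ^ n) * P := by rw [mul_assoc, ← (hcomm.pow_left n).eq, mul_assoc]
        _ ≤ P ^ n * P := mul_mono_left ih
        _ = P ^ (n + 1) := (pow_succ _ _).symm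
  obtain ⟨n, hn⟩ : ∃ n, e * (c + 1) = n + 1 :=
    Nat.exists_eq_succ_of_ne_zero (Nat.mul_pos he c.succ_pos).ne'
  have hPn : P ^ (n + 1) ≤ (ϖ : F) ^ (c + 1) • L := by
    rw [← hn, pow_mul, hP]; exact smul_pow_le Λ _ _
  have hjJ : 1 - i ∈ J := ⟨Λ.sub_mem Λ.one_mem (hT hiT), hi⟩
  -- the approximate idempotent
  have hcop : IsCoprime ((Polynomial.X : Polynomial ℤ) ^ (n + 1)) ((1 - Polynomial.X) ^ (n + 1)) :=
    IsCoprime.pow ⟨1, 1, by ring⟩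
  obtain ⟨p, q, hpq⟩ := hcop
  have hpq1 := congrArg (fun r => ((Polynomial.aeval (⟨i, hT hiT⟩ : Λ) r : Λ) : A)) hpq
  simp only [map_add, map_mul, map_pow, map_sub, map_one, Polynomial.aeval_X,
    Subalgebra.coe_add, Subalgebra.coe_mul, Subalgebra.coe_pow, Subalgebra.coe_sub,
    Subalgebra.coe_one] at hpq1
  set pi : Λ := Polynomial.aeval (⟨i, hT hiT⟩ : Λ) p
  set qi : Λ := Polynomial.aeval (⟨i, hT hiT⟩ : Λ) q
  obtain ⟨ε, hε⟩ : ∃ ε, ε = (pi : A) * i ^ (n + 1) := ⟨_, rfl⟩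
  have hε' : 1 - ε = (qi : A) * (1 - i) ^ (n + 1) := by rw [sub_eq_iff_eq_add, hε, add_comm, hpq1]
  have hεT : ε ∈ T ^ (n + 1) := by
    rw [hε]
    exact L_mul_pow Λ hLT.le n (Submodule.mul_mem_mul pi.2 (Submodule.pow_mem_pow _ hiT _))
  have hεJ : 1 - ε ∈ J ^ (n + 1) := by
    rw [hε']
    exact L_mul_pow Λ hLJ n (Submodule.mul_mem_mul qi.2 (Submodule.pow_mem_pow _ hjJ _))
  have hεT1 : ε ∈ T := pow_le_self Λ hT hLT.le n hεT
  have hεJ1 : 1 - ε ∈ J := pow_le_self Λ hJL hLJ n hεJ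
  obtain ⟨s, l, hl, hs⟩ := hc ε (by
    intro a ha
    have m1 : ε * a * (1 - ε) ∈ P ^ (n + 1) := hTnJn _ (Submodule.mul_mem_mul
      (pow_mul_L Λ hTL.le n (Submodule.mul_mem_mul hεT ha)) hεJ)
    have m2 : (1 - ε) * a * ε ∈ P ^ (n + 1) := hJnTn _ (Submodule.mul_mem_mul
      (pow_mul_L Λ hJL2 n (Submodule.mul_mem_mul hεJ ha)) hεT)
    have m3 := hPn ((P ^ (n + 1)).sub_mem m1 m2)
    obtain ⟨l, hl, hl2⟩ := (Submodule.mem_smul_pointwise_iff_exists _ _ _).1 m3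
    refine ⟨l, hl, ?_⟩
    have e1 : ε * a - a * ε = ε * a * (1 - ε) - (1 - ε) * a * ε := by noncomm_ring
    rw [e1, ← hl2, ← SubmonoidClass.coe_pow]; rfl)
  have hsΛ : s • (1 : A) ∈ Λ := by
    have : s • (1 : A) = ε - ϖ • l := by rw [hs]; abel
    rw [this]; exact Λ.sub_mem (hT hεT1) (Λ.smul_mem hl _)
  have hsO : s ∈ O := by
    by_contra hsO
    obtain ⟨u, hu⟩ := hval s hsO
    apply hone
    have : (1 : A) = ϖ • (u • (s • (1 : A))) := by
      change (1 : A) = (ϖ : F) • ((u : F) • (s • (1 : A)))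
      rw [smul_smul, smul_smul, mul_comm, mul_comm (ϖ : F), ← mul_assoc]
      rw [hu, one_smul]
    rw [this]
    exact hϖ _ (Λ.smul_mem hsΛ _)
  obtain ⟨s, rfl⟩ : ∃ s' : O, (s' : F) = s := ⟨⟨s, hsO⟩, rfl⟩
  have hs' : ε = s • (1 : A) + ϖ • l := hs
  rcases hunit s with hsu | ⟨s', hs2⟩
  · obtain ⟨v, rfl⟩ := hsu
    have h3 : ((v⁻¹ : Oˣ) : O) • ε = 1 - (-(((v⁻¹ : Oˣ) : O) • ϖ • l)) := by
      rw [hs', smul_add, smul_smul, Units.inv_mul, one_smul]; abel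
    have h4 : -(((v⁻¹ : Oˣ) : O) • ϖ • l) ∈ P := P.neg_mem (P.smul_mem _ (hϖ l hl))
    obtain ⟨z, hz, hz1⟩ := hlinv _ h4
    rw [← h3] at hz1
    have h5 : (1 : A) ∈ T := by
      rw [← hz1]
      exact hLT.le (Submodule.mul_mem_mul hz (T.smul_mem _ hεT1))
    apply le_antisymm hT
    intro a ha
    have := hLT.le (Submodule.mul_mem_mul ha h5)
    rwa [mul_one] at this
  · exfalso
    apply hTP
    have h3 : ε ∈ P := by
      rw [hs', hs2, mul_smul, ← smul_add]
      exact hϖ _ (Λ.add_mem (Λ.smul_mem Λ.one_mem _) hl)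
    intro t ht
    have h4 : t = t * ε + t * (1 - ε) := by noncomm_ring
    rw [h4]
    exact P.add_mem (hLP.le (Submodule.mul_mem_mul (hT ht) h3)) (hεJ1.2 t ht)

end fieldpart
end PicAux
namespace PicAux

section loc
variable {F A : Type} [Field F] [Ring A] [Algebra F A] {O : Subring F}

/-- The local hypotheses on an order. -/
structure LocalData (Λ : Subalgebra O A) (ϖ : O) (e : ℕ) : Prop where
  h0 : (ϖ : F) ≠ 0
  hden : ∀ f : F, ∃ n : ℕ, (ϖ : F) ^ n * f ∈ O
  hval : ∀ f : F, f ∉ O → ∃ u : O, f * u * ϖ = 1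
  hnu : ¬ IsUnit ϖ
  hunit : ∀ s : O, IsUnit s ∨ ϖ ∣ s
  hspan : Submodule.span F (Λ : Set A) = ⊤
  hfin : Module.Finite O Λ.toSubmodule
  he : 0 < e
  hP : (radSubG O A Λ) ^ e = (ϖ : F) • Λ.toSubmodule

/-- group of invertible two-sided fractional ideals -/
abbrev U (Λ : Subalgebra O A) : Type := (Corner (LL Λ))ˣ

theorem U_ext {Λ : Subalgebra O A} {s t : U Λ} (h : s.1.1 = t.1.1) : s = t :=
  Units.ext (Subtype.ext h)

theorem U_mul {Λ : Subalgebra O A} (s t : U Λ) : (s * t).1.1 = s.1.1 * t.1.1 := rfl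

theorem U_one {Λ : Subalgebra O A} : (1 : U Λ).1.1 = Λ.toSubmodule := rfl

/-- build an invertible ideal -/
def mkU (Λ : Subalgebra O A) (T T' : Submodule O A)
    (h1 : T * T' = Λ.toSubmodule) (h2 : T' * T = Λ.toSubmodule)
    (hLT : Λ.toSubmodule * T = T) (hTL : T * Λ.toSubmodule = T)
    (hLT' : Λ.toSubmodule * T' = T') (hTL' : T' * Λ.toSubmodule = T') : U Λ where
  val := ⟨T, hLT, hTL⟩
  inv := ⟨T', hLT', hTL'⟩
  val_inv := Subtype.ext h1
  inv_val := Subtype.ext h2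

/-- the ideal `f Λ` -/
def zU (Λ : Subalgebra O A) (f : F) (hf : f ≠ 0) : U Λ :=
  mkU Λ (f • Λ.toSubmodule) (f⁻¹ • Λ.toSubmodule)
    (by rw [smul_mul', mul_smul', LL, smul_smul, mul_inv_cancel₀ hf, one_smul])
    (by rw [smul_mul', mul_smul', LL, smul_smul, inv_mul_cancel₀ hf, one_smul])
    (by rw [mul_smul', LL]) (by rw [smul_mul', LL]) (by rw [mul_smul', LL]) (by rw [smul_mul', LL])

theorem zU_mul (Λ : Subalgebra O A) (f g : F) (hf : f ≠ 0) (hg : g ≠ 0) :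
    zU Λ (f * g) (mul_ne_zero hf hg) = zU Λ f hf * zU Λ g hg := by
  apply U_ext
  rw [U_mul]
  change (f * g) • Λ.toSubmodule = (f • Λ.toSubmodule) * (g • Λ.toSubmodule)
  rw [smul_mul', mul_smul', LL, smul_smul]

/-- bundled as a homomorphism -/
def zHom (Λ : Subalgebra O A) : Fˣ →* U Λ where
  toFun f := zU Λ f f.ne_zero
  map_one' := U_ext (by
    change ((1 : Fˣ) : F) • Λ.toSubmodule = Λ.toSubmodule
    rw [Units.val_one, one_smul])
  map_mul' f g := zU_mul Λ f g f.ne_zero g.ne_zero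

theorem zHom_val (Λ : Subalgebra O A) (f : Fˣ) : (zHom Λ f).1.1 = (f : F) • Λ.toSubmodule := rfl

theorem zHom_unit (Λ : Subalgebra O A) (f : Fˣ) (hf : (f : F) ∈ O) (hf' : (f : F)⁻¹ ∈ O) :
    zHom Λ f = 1 := by
  apply U_ext
  rw [zHom_val, U_one]
  apply le_antisymm
  · intro a ha
    obtain ⟨b, hb, rfl⟩ := (Submodule.mem_smul_pointwise_iff_exists _ _ _).1 ha
    exact Λ.smul_mem hb (⟨f, hf⟩ : O)
  · intro a ha
    refine (Submodule.mem_smul_pointwise_iff_exists _ _ _).2 ⟨(⟨_, hf'⟩ : O) • a, Λ.smul_mem ha _, ?_⟩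
    change (f : F) • ((f : F)⁻¹ • a) = a
    rw [smul_smul, mul_inv_cancel₀ f.ne_zero, one_smul]

variable {Λ : Subalgebra O A} {ϖ : O} {e : ℕ}

/-- the radical as an invertible ideal -/
def pU (H : LocalData Λ ϖ e) : U Λ :=
  mkU Λ (radSubG O A Λ) ((ϖ : F)⁻¹ • (Λ.toSubmodule * radSubG O A Λ ^ (e - 1) * Λ.toSubmodule))
    (by
      rw [mul_smul', ← mul_assoc, ← mul_assoc, rad_L, ← pow_succ', Nat.sub_add_cancel H.he, H.hP,
        smul_mul', LL, smul_smul, inv_mul_cancel₀ H.h0, one_smul])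
    (by
      rw [smul_mul', mul_assoc, L_rad, mul_assoc, ← pow_succ, Nat.sub_add_cancel H.he, H.hP,
        mul_smul', LL, smul_smul, inv_mul_cancel₀ H.h0, one_smul])
    (L_rad Λ) (rad_L Λ)
    (by rw [mul_smul', ← mul_assoc, ← mul_assoc, LL])
    (by rw [smul_mul', mul_assoc, LL])

theorem pU_val (H : LocalData Λ ϖ e) : (pU H).1.1 = radSubG O A Λ := rfl

theorem pU_pow (H : LocalData Λ ϖ e) (n : ℕ) :
    (pU H ^ n).1.1 = Λ.toSubmodule * radSubG O A Λ ^ n := by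
  rw [Units.val_pow_eq_pow_val, Corner.val_pow]; rfl

theorem pU_pow_e (H : LocalData Λ ϖ e) : pU H ^ e = zHom Λ (Units.mk0 _ H.h0) := by
  apply U_ext
  rw [pU_pow, H.hP, mul_smul', LL]; rfl

theorem pU_pow_le (H : LocalData Λ ϖ e) (n : ℕ) : (pU H ^ (n + 1)).1.1 ≤ radSubG O A Λ := by
  rw [pU_pow]
  exact (L_mul_pow Λ (L_rad Λ).le n).trans (pow_le_self Λ (rad_le Λ) (L_rad Λ).le n)

theorem pU_neg_not_le [Nontrivial A] (H : LocalData Λ ϖ e) (n : ℕ) :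
    ¬ (pU H ^ (-((n : ℤ) + 1))).1.1 ≤ Λ.toSubmodule := by
  intro h
  have h1 : pU H ^ (n + 1) * pU H ^ (-((n : ℤ) + 1)) = 1 := by
    rw [zpow_neg, mul_inv_eq_one]; exact_mod_cast rfl
  have h2 := congrArg (fun t : U Λ => t.1.1) h1
  simp only [U_mul, U_one] at h2
  apply one_notMem_rad Λ
  have h3 : (1 : A) ∈ Λ.toSubmodule := Λ.one_mem
  rw [← h2] at h3
  exact (rad_L Λ).le (mul_mono (pU_pow_le H n) h h3)

theorem pU_zpow_eq_one [Nontrivial A] (H : LocalData Λ ϖ e) (n : ℤ) (h : pU H ^ n = 1) : n = 0 := by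
  have main : ∀ m : ℕ, pU H ^ (-((m : ℤ) + 1)) ≠ 1 := by
    intro m hm
    apply pU_neg_not_le H m
    rw [hm]; exact le_rfl
  rcases lt_trichotomy n 0 with hn | hn | hn
  · exfalso
    apply main (-n - 1).toNat
    rw [Int.toNat_of_nonneg (by omega)]
    convert h using 2; ring
  · exact hn
  · exfalso
    apply main (n - 1).toNat
    rw [Int.toNat_of_nonneg (by omega), sub_add_cancel, zpow_neg, h, inv_one]

theorem bdd (H : LocalData Λ ϖ e) (t : U Λ) : ∃ N : ℕ,
    (pU H ^ (e * N) * t).1.1 ≤ Λ.toSubmodule ∧ (t * pU H ^ (e * N)).1.1 ≤ Λ.toSubmodule := by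
  have h1 : t.1.1 * (t⁻¹).1.1 = Λ.toSubmodule := congrArg Subtype.val t.mul_inv
  have h2 : (t⁻¹).1.1 * t.1.1 = Λ.toSubmodule := congrArg Subtype.val t.inv_mul
  have hc : ∀ y ∈ (t⁻¹).1.1 * t.1.1, ∃ N : ℕ, ∀ a ∈ t.1.1, ϖ ^ N • (a * y) ∈ Λ := by
    intro y hy
    induction hy using Submodule.mul_induction_on' with
    | mem_mul_mem b hb c hc =>
      obtain ⟨N, hN⟩ := exists_pow_smul_mem Λ ϖ H.hden H.hspan c
      refine ⟨N, fun a ha => ?_⟩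
      rw [← mul_assoc, ← mul_smul_comm]
      refine Λ.mul_mem ?_ hN
      exact h1.le (Submodule.mul_mem_mul ha hb)
    | add b _ c _ hb hc =>
      obtain ⟨N, hN⟩ := hb
      obtain ⟨M, hM⟩ := hc
      refine ⟨N + M, fun a ha => ?_⟩
      rw [mul_add, smul_add]
      refine Λ.add_mem ?_ ?_
      · rw [add_comm, pow_add, mul_smul]; exact Λ.smul_mem (hN a ha) _
      · rw [pow_add, mul_smul]; exact Λ.smul_mem (hM a ha) _
  obtain ⟨N, hN⟩ := hc 1 (h2.symm ▸ Λ.one_mem)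
  have hN' : (ϖ : F) ^ N • t.1.1 ≤ Λ.toSubmodule := by
    intro a ha
    obtain ⟨b, hb, rfl⟩ := (Submodule.mem_smul_pointwise_iff_exists _ _ _).1 ha
    have := hN b hb
    rw [mul_one] at this
    rw [← SubmonoidClass.coe_pow]; exact this
  have hp : pU H ^ (e * N) = zHom Λ (Units.mk0 _ H.h0 ^ N) := by
    rw [pow_mul, pU_pow_e, map_pow]
  refine ⟨N, ?_, ?_⟩
  · rw [hp, U_mul, zHom_val, smul_mul', t.1.2.1]; simpa using hN'
  · rw [hp, U_mul, zHom_val, mul_smul', t.1.2.2]; simpa using hN'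

theorem surj [Algebra.IsCentral F A] [FiniteDimensional F A] [Nontrivial A]
    (H : LocalData Λ ϖ e) (t : U Λ) : ∃ n : ℤ, t = pU H ^ n := by
  obtain ⟨N, hN, -⟩ := bdd H t
  obtain ⟨M, -, hM⟩ := bdd H t⁻¹
  obtain ⟨n, hn, hmax⟩ := Int.exists_greatest_of_bdd
    (P := fun n : ℤ => (pU H ^ (-n) * t).1.1 ≤ Λ.toSubmodule)
    ⟨(e * M : ℕ), by
      intro n hn
      by_contra hlt
      have h1 : (pU H ^ (-n) * t) * (t⁻¹ * pU H ^ (e * M)) =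
          pU H ^ (-((((n - (e * M : ℕ)) - 1).toNat : ℤ) + 1)) := by
        rw [Int.toNat_of_nonneg (by omega), ← zpow_natCast, mul_assoc, mul_inv_cancel_left,
          ← zpow_add]
        congr 1; ring
      apply pU_neg_not_le H _
      rw [← h1, U_mul]
      exact (mul_mono hn hM).trans (LL Λ).le⟩
    ⟨-(e * N : ℕ), by
      change (pU H ^ (- -((e * N : ℕ) : ℤ)) * t).1.1 ≤ Λ.toSubmodule
      rw [neg_neg, zpow_natCast]; exact hN⟩
  refine ⟨n, ?_⟩
  have hfin := H.hfin
  obtain ⟨s, hs⟩ : ∃ s, s = pU H ^ (-n) * t := ⟨_, rfl⟩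
  rw [← hs] at hn
  have h1 : s.1.1 * (s⁻¹).1.1 = Λ.toSubmodule := congrArg Subtype.val s.mul_inv
  have h2 : (s⁻¹).1.1 * s.1.1 = Λ.toSubmodule := congrArg Subtype.val s.inv_mul
  have h3 := key Λ ϖ H.hden H.hval H.hnu H.hunit H.hspan e H.he H.hP h1 h2
    s.1.2.1 s.1.2.2 (s⁻¹).1.2.1 (s⁻¹).1.2.2 hn (by
      intro hsP
      have h4 := hmax (n + 1) (by
        have h5 : pU H ^ (-(n + 1)) * t = (pU H)⁻¹ * s := by
          rw [hs, ← mul_assoc, neg_add, add_comm, zpow_add, zpow_neg_one]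
        rw [h5, U_mul]
        refine (mul_mono_right hsP).trans ?_
        exact (congrArg Subtype.val (pU H).inv_mul).le)
      omega)
  have h6 : s = 1 := U_ext h3
  rw [h6] at hs
  rw [zpow_neg] at hs
  exact (inv_mul_eq_one.1 hs.symm).symm

/-- membership in the twist condition -/
theorem twist_iff (H : LocalData Λ ϖ e) (t : U Λ) (m : ℤ) :
    t.1.1 * radSubG O A Λ ^ m.toNat = Λ.toSubmodule * radSubG O A Λ ^ (-m).toNat ↔
      t = pU H ^ (-m) := by
  have h1 : t.1.1 * radSubG O A Λ ^ m.toNat = (t * pU H ^ m.toNat).1.1 := by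
    rw [U_mul, pU_pow, ← mul_assoc, t.1.2.2]
  rw [h1, ← pU_pow H]
  have h2 : (t * pU H ^ m.toNat).1.1 = (pU H ^ (-m).toNat).1.1 ↔
      t * pU H ^ m.toNat = pU H ^ (-m).toNat := ⟨fun h => U_ext h, fun h => by rw [h]⟩
  rw [h2, ← eq_mul_inv_iff_mul_eq, ← zpow_natCast, ← zpow_natCast, ← zpow_neg, ← zpow_add]
  have : (((-m).toNat : ℤ) + -(m.toNat : ℤ)) = -m := by omega
  rw [this]

end loc

end PicAux
namespace PicAux

theorem mem_jac {R : Type} [CommRing R] (ϖ : R) (hnu : ¬ IsUnit ϖ)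
    (hunit : ∀ s : R, IsUnit s ∨ ϖ ∣ s) : ϖ ∈ (⊥ : Ideal R).jacobson := by
  rw [Ideal.mem_jacobson_bot]
  intro y
  refine (hunit _).resolve_right fun h => hnu ?_
  exact isUnit_of_dvd_one ((dvd_add_right (Dvd.intro y rfl)).1 h)

theorem smul_mem_rad {R A : Type} [CommRing R] [Ring A] [Algebra R A] (Λ : Subalgebra R A) (ϖ : R)
    (hnu : ¬ IsUnit ϖ) (hunit : ∀ s : R, IsUnit s ∨ ϖ ∣ s) [Module.Finite R Λ.toSubmodule]
    (a : A) (ha : a ∈ Λ) : ϖ • a ∈ radSubG R A Λ := by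
  have hfin : Module.Finite R Λ := ‹Module.Finite R Λ.toSubmodule›
  refine (mem_rad Λ).2 ⟨Λ.smul_mem ha ϖ, Ideal.mem_jacobson_iff.2 fun y => ?_⟩
  let w : Λ := y * ⟨a, ha⟩
  let N : Submodule R Λ := (Ideal.span {ϖ • w + 1}).restrictScalars R
  have hN : (⊤ : Submodule R Λ) ≤ N := by
    apply Submodule.le_of_le_smul_of_le_jacobson_bot (I := Ideal.span {ϖ}) Module.Finite.fg_top
    · rw [Ideal.span_singleton_le_iff_mem]; exact mem_jac ϖ hnu hunit
    · intro b _
      have : b = b * (ϖ • w + 1) - ϖ • (b * w) := by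
        rw [mul_add, mul_smul_comm, mul_one]; abel
      rw [this]
      apply Submodule.sub_mem
      · exact Submodule.mem_sup_left (Ideal.mul_mem_left _ b (Ideal.mem_span_singleton_self _))
      · exact Submodule.mem_sup_right (Submodule.smul_mem_smul (Ideal.mem_span_singleton_self _)
          trivial)
  have h1 : (1 : Λ) ∈ Ideal.span {ϖ • w + 1} := hN (x := 1) trivial
  obtain ⟨z, hz⟩ := Ideal.mem_span_singleton'.1 h1
  refine ⟨z, ?_⟩
  rw [Ideal.mem_bot]
  have h2 : (⟨ϖ • a, Λ.smul_mem ha ϖ⟩ : Λ) = ϖ • ⟨a, ha⟩ := rfl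
  rw [h2, mul_assoc, mul_smul_comm, sub_eq_zero, ← hz, mul_add, mul_one]

section curve
variable {k : Type} [Field k] (C : AlgCurve k)

/-- `ord` as a homomorphism. -/
def ordHom (x : C.Point) : C.Fˣ →* Multiplicative ℤ where
  toFun f := Multiplicative.ofAdd (C.ord x f)
  map_one' := by rw [Units.val_one, C.ord_one]; rfl
  map_mul' f g := by rw [Units.val_mul, C.ord_mul x _ _ f.ne_zero g.ne_zero]; rfl

theorem ord_zpow (x : C.Point) (f : C.Fˣ) (n : ℤ) :
    C.ord x ((f ^ n : C.Fˣ) : C.F) = n * C.ord x f := by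
  have := congrArg Multiplicative.toAdd (map_zpow (ordHom C x) f n)
  rw [toAdd_zpow] at this
  simpa [ordHom] using this

theorem ord_inv (x : C.Point) (f : C.F) (hf : f ≠ 0) : C.ord x f⁻¹ = - C.ord x f := by
  have := C.ord_mul x f f⁻¹ hf (inv_ne_zero hf)
  rw [mul_inv_cancel₀ hf, C.ord_one] at this
  omega

theorem mem_O (x : C.Point) (f : C.F) (hf : f ≠ 0) : f ∈ C.O x ↔ 0 ≤ C.ord x f :=
  ⟨fun h => Or.resolve_left h hf, fun h => Or.inr h⟩

variable {C}

theorem nu_O {x : C.Point} (ϖ : C.O x) (h1 : C.ord x ϖ = 1) (h0 : (ϖ : C.F) ≠ 0) : ¬ IsUnit ϖ := by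
  intro h
  obtain ⟨v, hv⟩ := h.exists_right_inv
  have hv' : (ϖ : C.F) * (v : C.F) = 1 := congrArg Subtype.val hv
  have hv0 : (v : C.F) ≠ 0 := right_ne_zero_of_mul_eq_one hv'
  have h2 := C.ord_mul x ϖ v h0 hv0
  rw [hv', C.ord_one, h1] at h2
  have := (mem_O C x v hv0).1 v.2
  omega

theorem unit_O {x : C.Point} (ϖ : C.O x) (h1 : C.ord x ϖ = 1) (h0 : (ϖ : C.F) ≠ 0) (s : C.O x) :
    IsUnit s ∨ ϖ ∣ s := by
  by_cases hs : (s : C.F) = 0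
  · right
    have : s = 0 := Subtype.ext hs
    rw [this]; exact dvd_zero _
  have h2 := (mem_O C x s hs).1 s.2
  rcases h2.eq_or_lt with h3 | h3
  · left
    have h4 : (s : C.F)⁻¹ ∈ C.O x := by
      rw [mem_O C x _ (inv_ne_zero hs), ord_inv C x _ hs]; omega
    exact IsUnit.of_mul_eq_one ⟨_, h4⟩ (Subtype.ext (mul_inv_cancel₀ hs))
  · right
    have h4 : (ϖ : C.F)⁻¹ * s ∈ C.O x := by
      rw [mem_O C x _ (mul_ne_zero (inv_ne_zero h0) hs),
        C.ord_mul x _ _ (inv_ne_zero h0) hs, ord_inv C x _ h0]; omega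
    exact ⟨⟨_, h4⟩, Subtype.ext (mul_inv_cancel_left₀ h0 _).symm⟩

theorem localData {A : Type} [Ring A] [Algebra C.F A] [Nontrivial A] (D : SheafOrder C A)
    (x : C.Point) (e : ℕ) (he : 0 < e) (ϖ : C.O x) (h1 : C.ord x ϖ = 1)
    (hP : (radSubG ↥(C.O x) A (D.Λ x)) ^ e = ϖ • (D.Λ x).toSubmodule) :
    LocalData (D.Λ x) ϖ e := by
  have hfin : Module.Finite (C.O x) (D.Λ x).toSubmodule := D.lattice.1 x
  have h0 : (ϖ : C.F) ≠ 0 := by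
    intro h0
    obtain ⟨f, hf0, hf1⟩ := C.ord_exists_uniformizer x
    have hfO : f ∈ C.O x := (mem_O C x f hf0).2 (by omega)
    have h2 := smul_mem_rad (D.Λ x) (⟨f, hfO⟩ : C.O x) (nu_O _ hf1 hf0) (unit_O _ hf1 hf0)
      1 (D.Λ x).one_mem
    have h3 := Submodule.pow_mem_pow _ h2 e
    rw [hP] at h3
    obtain ⟨b, hb, hb2⟩ := (Submodule.mem_smul_pointwise_iff_exists _ _ _).1 h3
    have h4 : ϖ = 0 := Subtype.ext h0
    rw [h4, zero_smul] at hb2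
    have h5 : (f • (1 : A)) ^ e = 0 := hb2.symm
    rw [smul_pow, one_pow] at h5
    rcases smul_eq_zero.1 h5 with h6 | h6
    · exact pow_ne_zero e hf0 h6
    · exact one_ne_zero h6
  refine ⟨h0, ?_, ?_, nu_O ϖ h1 h0, unit_O ϖ h1 h0, D.lattice.2.1 x, hfin, he, hP⟩
  · intro f
    by_cases hf : f = 0
    · exact ⟨0, by rw [hf, mul_zero]; exact (C.O x).zero_mem⟩
    refine ⟨(-C.ord x f).toNat, ?_⟩
    rw [mem_O C x _ (mul_ne_zero (pow_ne_zero _ h0) hf), C.ord_mul x _ _ (pow_ne_zero _ h0) hf]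
    have := ord_zpow C x (Units.mk0 _ h0) ((-C.ord x f).toNat : ℤ)
    rw [zpow_natCast, Units.val_pow_eq_pow_val, Units.val_mk0, h1] at this
    rw [this]; omega
  · intro f hf
    have hf0 : f ≠ 0 := fun h => hf (h ▸ (C.O x).zero_mem)
    rw [mem_O C x f hf0] at hf
    have hm : f⁻¹ * (ϖ : C.F)⁻¹ ∈ C.O x := by
      rw [mem_O C x _ (mul_ne_zero (inv_ne_zero hf0) (inv_ne_zero h0)),
        C.ord_mul x _ _ (inv_ne_zero hf0) (inv_ne_zero h0), ord_inv C x _ hf0, ord_inv C x _ h0]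
      omega
    refine ⟨⟨_, hm⟩, ?_⟩
    change f * (f⁻¹ * (ϖ : C.F)⁻¹) * ϖ = 1
    field_simp

theorem zHom_eq {A : Type} [Ring A] [Algebra C.F A] {x : C.Point} {Λ : Subalgebra (C.O x) A}
    {e : ℕ} {ϖ : C.O x} (H : LocalData Λ ϖ e) (h1 : C.ord x ϖ = 1) (f : C.Fˣ) :
    zHom Λ f = pU H ^ ((e : ℤ) * C.ord x f) := by
  rw [zpow_mul, zpow_natCast, pU_pow_e, ← map_zpow, ← inv_mul_eq_one, ← map_inv, ← map_mul]
  set g := f⁻¹ * (Units.mk0 (ϖ : C.F) H.h0) ^ (C.ord x f) with hg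
  have h2 : C.ord x (g : C.F) = 0 := by
    rw [hg, Units.val_mul, C.ord_mul x _ _ (Units.ne_zero _) (Units.ne_zero _), ord_zpow,
      Units.val_inv_eq_inv_val, ord_inv C x _ f.ne_zero, Units.val_mk0, h1]; ring
  apply zHom_unit
  · rw [mem_O C x _ g.ne_zero, h2]
  · rw [mem_O C x _ (inv_ne_zero g.ne_zero), ord_inv C x _ g.ne_zero, h2]; simp

theorem exists_tU {A : Type} [Ring A] [Algebra C.F A] {D : SheafOrder C A}
    {T : ∀ x : C.Point, Submodule ↥(C.O x) A} (hT : IsInvBimodFamily C A D T) (x : C.Point) :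
    ∃ t : U (D.Λ x), t.1.1 = T x := by
  obtain ⟨T', h1, h2⟩ := hT.2.2.1 x
  have hl := hT.1 x
  have hr := hT.2.1 x
  have hLL := LL (D.Λ x)
  refine ⟨mkU (D.Λ x) (T x) ((D.Λ x).toSubmodule * T' * (D.Λ x).toSubmodule) ?_ ?_ hl hr ?_ ?_, rfl⟩
  · rw [← mul_assoc, ← mul_assoc, hr, h1, hLL]
  · rw [mul_assoc, hl, mul_assoc, h2, hLL]
  · rw [← mul_assoc, ← mul_assoc, hLL]
  · rw [mul_assoc, hLL]

end curve
end PicAux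

theorem pic_exact_sequence
    (k : Type) [Field k] [PerfectField k] (C : AlgCurve k)
    (A : Type) [Ring A] [Algebra C.F A]
    [Algebra.IsCentral C.F A] [IsSimpleRing A] [FiniteDimensional C.F A]
    (d : ℕ) (hd : Module.finrank C.F A = d ^ 2)
    (D : SheafOrder C A) (hher : D.IsHereditary) (hprin : ∀ x, D.IsPrincipalAt x)
    (ex : C.Point → ℕ) (hexpos : ∀ x, 0 < ex x) (hex : ∀ x, D.HasIndexAt x (ex x)) :
    -- injectivity of `F*/k* → Div(D)`
    (∀ f g : C.F, f ≠ 0 → g ≠ 0 → (∀ x, C.ord x f = C.ord x g) →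
      ∃ c : k, c ≠ 0 ∧ f = algebraMap k C.F c * g) ∧
    -- existence of `D(m)` for every divisor `m ∈ Div(D)`
    (∀ m : C.Point → ℤ, {x | m x ≠ 0}.Finite →
      ∃ T : ∀ x : C.Point, Submodule ↥(C.O x) A, IsTwistBimod C A D m T) ∧
    -- exactness in the middle: `D(m)` is trivial iff `m` is a principal divisor
    (∀ m : C.Point → ℤ, {x | m x ≠ 0}.Finite →
      ∀ T : ∀ x : C.Point, Submodule ↥(C.O x) A, IsTwistBimod C A D m T →
        ((∃ f : C.F, f ≠ 0 ∧
            ∀ x, (T x : Set A) = (fun a => f • a) '' ((D.Λ x : Set A))) ↔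
          (∃ f : C.F, f ≠ 0 ∧ ∀ x, m x = (ex x : ℤ) * C.ord x f))) ∧
    -- surjectivity: every invertible bimodule is a `D(m)`
    (∀ T : ∀ x : C.Point, Submodule ↥(C.O x) A, IsInvBimodFamily C A D T →
      ∃ m : C.Point → ℤ, {x | m x ≠ 0}.Finite ∧ IsTwistBimod C A D m T) := by
  choose ϖ hϖ1 hϖ2 using hex
  have H : ∀ x, PicAux.LocalData (D.Λ x) (ϖ x) (ex x) := fun x =>
    PicAux.localData D x (ex x) (hexpos x) (ϖ x) (hϖ1 x) (hϖ2 x)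
  refine ⟨?_, ?_, ?_, ?_⟩
  · intro f g hf hg hfg
    have h0 : f * g⁻¹ ≠ 0 := mul_ne_zero hf (inv_ne_zero hg)
    obtain ⟨c, hc⟩ := C.constants (f * g⁻¹) h0 (fun x => by
      rw [C.ord_mul x _ _ hf (inv_ne_zero hg), PicAux.ord_inv C x _ hg, hfg x]; omega)
    refine ⟨c, ?_, ?_⟩
    · rintro rfl; exact h0 (by rw [← hc, map_zero])
    · rw [hc, inv_mul_cancel_right₀ hg]
  · intro m hm
    refine ⟨fun x => (PicAux.pU (H x) ^ (-m x)).1.1, ⟨?_, ?_, ?_, ?_⟩, ?_⟩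
    · intro x; exact (PicAux.pU (H x) ^ (-m x)).1.2.1
    · intro x; exact (PicAux.pU (H x) ^ (-m x)).1.2.2
    · intro x
      exact ⟨((PicAux.pU (H x) ^ (-m x))⁻¹).1.1,
        congrArg Subtype.val (PicAux.pU (H x) ^ (-m x)).mul_inv,
        congrArg Subtype.val (PicAux.pU (H x) ^ (-m x)).inv_mul⟩
    · refine hm.subset fun x hx hmx => hx ?_
      change (PicAux.pU (H x) ^ (-m x)).1.1 = _
      rw [hmx, neg_zero, zpow_zero]; rfl
    · intro x
      exact (PicAux.twist_iff (H x) _ _).2 rfl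
  · intro m hm T hT
    choose t ht using PicAux.exists_tU hT.1
    have htm : ∀ x, t x = PicAux.pU (H x) ^ (-m x) := fun x =>
      (PicAux.twist_iff (H x) _ _).1 (by rw [ht]; exact hT.2 x)
    have hiff : ∀ (f : C.Fˣ) (x : C.Point),
        (T x : Set A) = (fun a => (f : C.F) • a) '' ((D.Λ x : Set A)) ↔
          m x = (ex x : ℤ) * C.ord x ((f⁻¹ : C.Fˣ) : C.F) := by
      intro f x
      have e1 : (T x : Set A) = (fun a => (f : C.F) • a) '' ((D.Λ x : Set A)) ↔
          t x = PicAux.zHom (D.Λ x) f := by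
        constructor
        · intro h
          apply PicAux.U_ext
          rw [ht, PicAux.zHom_val]
          exact SetLike.coe_injective h
        · intro h
          rw [← ht x, h, PicAux.zHom_val]
          rfl
      rw [e1, htm, PicAux.zHom_eq (H x) (hϖ1 x), Units.val_inv_eq_inv_val,
        PicAux.ord_inv C x _ f.ne_zero]
      constructor
      · intro h
        rw [← mul_inv_eq_one, ← zpow_neg, ← zpow_add] at h
        have := PicAux.pU_zpow_eq_one (H x) _ h
        linarith
      · intro h
        congr 1; rw [h]; ring
    constructor
    · rintro ⟨f, hf, h⟩
      exact ⟨((Units.mk0 f hf)⁻¹ : C.Fˣ), Units.ne_zero _, fun x => (hiff (Units.mk0 f hf) x).1 (h x)⟩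
    · rintro ⟨f, hf, h⟩
      refine ⟨((Units.mk0 f hf)⁻¹ : C.Fˣ), Units.ne_zero _, fun x => (hiff _ x).2 ?_⟩
      rw [inv_inv]; exact h x
  · intro T hT
    choose t ht using PicAux.exists_tU hT
    have hex : ∀ x, ∃ m : ℤ, t x = PicAux.pU (H x) ^ (-m) := fun x => by
      obtain ⟨n, hn⟩ := PicAux.surj (H x) (t x)
      exact ⟨-n, by rw [neg_neg]; exact hn⟩
    choose m hm using hex
    refine ⟨m, ?_, hT, fun x => ?_⟩
    · refine hT.2.2.2.subset fun x hx hTx => hx ?_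
      have h1 : t x = 1 := PicAux.U_ext (by rw [ht, hTx]; rfl)
      rw [hm x] at h1
      have := PicAux.pU_zpow_eq_one (H x) _ h1
      omega
    · have := (PicAux.twist_iff (H x) (t x) (m x)).2 (hm x)
      rwa [ht] at this
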